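/- arXiv:1604.08234 — 2 statements merged into one kernel-verified Lean document; each statement's English description precedes it below -/
import Mathlib

section
/- Let (G,w) be an energy game, let c ≥ n be an integer, let B = ⌊c/n⌋, and let v be a node with penalty at least B. Then e*_{G,w_B}(v) ≤ e*_{G,w}(v) ≤ e*_{G,w_B}(v) + nB ≤ e*_{G,w_B}(v) + c. -/
/-!
Common definitions for energy games (Brim et al. style), following the paper's
definitions: a game graph is a finite directed graph in which every node has
out-degree at least one, together with a partition of the nodes into Alice's
nodes `VA` and Bob's nodes (the complement of `VA`).  Strategies are positional.
For a fixed pair of strategies the play from a node `s` is the orbit of the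
induced successor function, and the minimal sufficient energy at `s` is the
least initial energy that keeps the running energy nonnegative forever, i.e.
`⨆ i, (-(weight of the length-i prefix))⁺ ∈ ℕ∞`; this coincides with
`∞` when the reachable cycle is negative and with `max (0, -min_P w(P))`
(minimum over simple paths `P` from `s`) otherwise.
-/

open scoped BigOperators

universe u

structure GameGraph (V : Type u) [Fintype V] [DecidableEq V] where
  E : Finset (V × V)
  VA : Finset V
  exists_succ : ∀ v : V, ∃ u : V, (v, u) ∈ E

namespace GameGraph

variable {V : Type u} [Fintype V] [DecidableEq V]

/-- Positional strategies of Alice: a choice of an out-edge at every node of Alice. -/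
def AliceStrategy (G : GameGraph V) : Type u :=
  {σ : V → V // ∀ u ∈ G.VA, (u, σ u) ∈ G.E}

/-- Positional strategies of Bob: a choice of an out-edge at every node of Bob. -/
def BobStrategy (G : GameGraph V) : Type u :=
  {τ : V → V // ∀ u : V, u ∉ G.VA → (u, τ u) ∈ G.E}

/-- The successor function of `G(σ,τ)`, the graph in which every node keeps only the
out-edge chosen by its owner's strategy. -/
def play (G : GameGraph V) (σ : G.AliceStrategy) (τ : G.BobStrategy) (v : V) : V :=
  if v ∈ G.VA then σ.1 v else τ.1 v

/-- Total weight of the length-`i` prefix of the unique path from `s` in the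
functional graph with successor function `f`. -/
def prefixWeight (w : V → V → ℤ) (f : V → V) (s : V) (i : ℕ) : ℤ :=
  ∑ j ∈ Finset.range i, w (f^[j] s) (f^[j + 1] s)

/-- The minimal sufficient energy `e*_{G(σ,τ),w}(s)` at `s` for a fixed pair of
strategies with induced successor function `f`:  the least initial energy
(in `ℕ∞ = ℤ≥0 ∪ {∞}`) keeping the running energy nonnegative forever.  It is `∞`
iff the unique cycle reachable from `s` is negative, and `max (0, -min_P w(P))`
(minimum over simple paths from `s`) otherwise. -/
noncomputable def stratEnergy (w : V → V → ℤ) (f : V → V) (s : V) : ℕ∞ :=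
  ⨆ i : ℕ, ((-(prefixWeight w f s i)).toNat : ℕ∞)

/-- The minimal sufficient energy `e*_{G,w}(s) = min_σ max_τ e*_{G(σ,τ),w}(s)`. -/
noncomputable def minEnergy (G : GameGraph V) (w : V → V → ℤ) (s : V) : ℕ∞ :=
  ⨅ σ : G.AliceStrategy, ⨆ τ : G.BobStrategy, stratEnergy w (G.play σ τ) s

/-- Alice wins at `s` iff the minimal sufficient energy at `s` is finite. -/
noncomputable def AliceWins (G : GameGraph V) (w : V → V → ℤ) (s : V) : Prop :=
  G.minEnergy w s ≠ ⊤

/-- The canonical embedding `ℕ∞ = ℤ≥0 ∪ {∞} → ℤ ∪ {∞}` (extended arithmetic: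
`∞ + x = ∞`, `∞ ≥ x`). -/
def toZInf (x : ℕ∞) : WithTop ℤ :=
  if x = ⊤ then ⊤ else ((x.toNat : ℤ) : WithTop ℤ)

/-- `max (x - z, 0)` for `x : ℕ∞` and `z : ℤ`, with `∞ - z = ∞`. -/
def esub (x : ℕ∞) (z : ℤ) : ℕ∞ :=
  if x = ⊤ then ⊤ else ((((x.toNat : ℤ) - z).toNat : ℕ) : ℕ∞)

/-- The successors of `u` in `G`. -/
def succs (G : GameGraph V) (u : V) : Finset V :=
  (G.E.filter (fun p => p.1 = u)).image Prod.snd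

/-- The weight function with every weight rounded up to the nearest multiple of `B`:
`w_B(u,v) = ⌈w(u,v)/B⌉·B`. -/
def roundW (w : V → V → ℤ) (B : ℤ) : V → V → ℤ :=
  fun u v => ⌈(w u v : ℚ) / (B : ℚ)⌉ * B

/-- `W = max_{(u,v) ∈ E} |w(u,v)|`. -/
def maxAbsW (G : GameGraph V) (w : V → V → ℤ) : ℕ :=
  G.E.sup (fun p => (w p.1 p.2).natAbs)

/-- A strategy `τ` of Bob is optimal if `e*_{G(σ,τ),w}(s) ≥ e*_{G,w}(s)` for every
node `s` and every strategy `σ` of Alice. -/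
noncomputable def IsOptimalBob (G : GameGraph V) (w : V → V → ℤ) (τ : G.BobStrategy) : Prop :=
  ∀ (s : V) (σ : G.AliceStrategy), G.minEnergy w s ≤ stratEnergy w (G.play σ τ) s

/-- Total weight of the cycle of length `L` through `x` in the functional graph `f`. -/
def cycleWeight (w : V → V → ℤ) (f : V → V) (x : V) (L : ℕ) : ℤ :=
  ∑ j ∈ Finset.range L, w (f^[j] x) (f^[j + 1] x)

/-- A node `s` has penalty at least `D ≥ 0` if there is an optimal strategy `τ*` of Bob
such that for every strategy `σ` of Alice the unique cycle `C` reachable from `s` in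
`G(σ,τ*)` satisfies: if `w(C) < 0` then the average weight `w(C)/|C|` is at most `-D`.
(The cycle is described by any node `x` on it, reachable from `s`, together with its
minimal period `L`.) -/
noncomputable def HasPenaltyAtLeast (G : GameGraph V) (w : V → V → ℤ) (s : V) (D : ℝ) : Prop :=
  ∃ τ : G.BobStrategy, G.IsOptimalBob w τ ∧
    ∀ σ : G.AliceStrategy, ∀ x : V, (∃ i : ℕ, (G.play σ τ)^[i] s = x) →
      ∀ L : ℕ, 0 < L → (G.play σ τ)^[L] x = x →
        (∀ k : ℕ, 0 < k → k < L → (G.play σ τ)^[k] x ≠ x) →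
        cycleWeight w (G.play σ τ) x L < 0 →
        ((cycleWeight w (G.play σ τ) x L : ℝ) / (L : ℝ) ≤ -D)

end GameGraph

namespace GameGraph

section Play

variable {V : Type u}

theorem le_roundW (w : V → V → ℤ) {B : ℤ} (hB : 0 < B) (a b : V) :
    w a b ≤ roundW w B a b := by
  have hB' : (0 : ℚ) < B := by exact_mod_cast hB
  have h := (div_le_iff₀ hB').1 (Int.le_ceil ((w a b : ℚ) / (B : ℚ)))
  unfold roundW
  exact_mod_cast h

theorem roundW_lt_add (w : V → V → ℤ) {B : ℤ} (hB : 0 < B) (a b : V) :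
    roundW w B a b < w a b + B := by
  have hB' : (0 : ℚ) < B := by exact_mod_cast hB
  have h := mul_lt_mul_of_pos_right (Int.ceil_lt_add_one ((w a b : ℚ) / (B : ℚ))) hB'
  rw [add_mul, div_mul_cancel₀ _ hB'.ne', one_mul] at h
  unfold roundW
  exact_mod_cast h

theorem prefixWeight_mono {w w' : V → V → ℤ} (h : ∀ a b, w a b ≤ w' a b) (f : V → V)
    (s : V) (i : ℕ) : prefixWeight w f s i ≤ prefixWeight w' f s i :=
  Finset.sum_le_sum fun _ _ => h _ _

theorem prefixWeight_add (w : V → V → ℤ) (f : V → V) (s : V) (i j : ℕ) :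
    prefixWeight w f s (i + j) = prefixWeight w f s i + prefixWeight w f (f^[i] s) j := by
  unfold prefixWeight
  rw [Finset.sum_range_add]
  congr 1
  refine Finset.sum_congr rfl fun k _ => ?_
  rw [← Function.iterate_add_apply, ← Function.iterate_add_apply]
  rw [show k + i = i + k by omega, show k + 1 + i = i + k + 1 by omega]

theorem prefixWeight_mul_of_isPeriodicPt (w : V → V → ℤ) {f : V → V} {x : V} {L : ℕ}
    (hx : f^[L] x = x) (k : ℕ) : prefixWeight w f x (L * k) = k * prefixWeight w f x L := by
  induction k with
  | zero => simp [prefixWeight]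
  | succ k ih =>
    rw [Nat.mul_succ, add_comm, prefixWeight_add, hx, ih]
    push_cast
    ring

theorem prefixWeight_roundW_le (w : V → V → ℤ) {B : ℤ} (hB : 0 < B) (f : V → V) (s : V)
    (i : ℕ) : prefixWeight (roundW w B) f s i ≤ prefixWeight w f s i + i * B := by
  have h : prefixWeight (roundW w B) f s i
      ≤ ∑ j ∈ Finset.range i, (w (f^[j] s) (f^[j + 1] s) + B) :=
    Finset.sum_le_sum fun _ _ => (roundW_lt_add w hB _ _).le
  simpa [Finset.sum_add_distrib, prefixWeight] using h

theorem prefixWeight_roundW_lt (w : V → V → ℤ) {B : ℤ} (hB : 0 < B) (f : V → V) (s : V)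
    {i : ℕ} (hi : 0 < i) : prefixWeight (roundW w B) f s i < prefixWeight w f s i + i * B := by
  have h : prefixWeight (roundW w B) f s i
      < ∑ j ∈ Finset.range i, (w (f^[j] s) (f^[j + 1] s) + B) :=
    Finset.sum_lt_sum_of_nonempty (Finset.nonempty_range_iff.2 hi.ne')
      fun _ _ => roundW_lt_add w hB _ _
  simpa [Finset.sum_add_distrib, prefixWeight] using h

theorem neg_prefixWeight_le_stratEnergy (w : V → V → ℤ) (f : V → V) (s : V) (i : ℕ) :
    ((-(prefixWeight w f s i)).toNat : ℕ∞) ≤ stratEnergy w f s :=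
  le_iSup (fun i : ℕ => ((-(prefixWeight w f s i)).toNat : ℕ∞)) i

theorem stratEnergy_anti {w w' : V → V → ℤ} (h : ∀ a b, w a b ≤ w' a b) (f : V → V) (s : V) :
    stratEnergy w' f s ≤ stratEnergy w f s := by
  refine iSup_mono fun i => ?_
  have := prefixWeight_mono h f s i
  exact_mod_cast Int.toNat_le_toNat (by omega)

/-- Every orbit reaches a cycle, and the whole cycle is traversed within `|V|` steps. -/
theorem exists_minimal_cycle [Fintype V] (f : V → V) (s : V) :
    ∃ a L : ℕ, 0 < L ∧ a + L ≤ Fintype.card V ∧ f^[L] (f^[a] s) = f^[a] s ∧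
      ∀ k : ℕ, 0 < k → k < L → f^[k] (f^[a] s) ≠ f^[a] s := by
  obtain ⟨i, j, hij, heq⟩ := Fintype.exists_ne_map_eq_of_card_lt
    (fun i : Fin (Fintype.card V + 1) => f^[i] s) (by simp)
  wlog hlt : i < j generalizing i j
  · exact this j i hij.symm heq.symm (lt_of_le_of_ne (not_lt.1 hlt) hij.symm)
  have hlt' : (i : ℕ) < j := hlt
  have hper : Function.IsPeriodicPt f (j - i : ℕ) (f^[i] s) := by
    unfold Function.IsPeriodicPt Function.IsFixedPt
    rw [← Function.iterate_add_apply, Nat.sub_add_cancel hlt'.le]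
    exact heq.symm
  have hpos : 0 < (j - i : ℕ) := by omega
  refine ⟨i, Function.minimalPeriod f (f^[i] s), hper.minimalPeriod_pos hpos, ?_,
    Function.isPeriodicPt_minimalPeriod f _, fun k hk hkL h => ?_⟩
  · have := hper.minimalPeriod_le hpos
    omega
  · exact Function.not_isPeriodicPt_of_pos_of_lt_minimalPeriod hk.ne' hkL h

theorem stratEnergy_eq_top_of_neg_cycle {w : V → V → ℤ} {f : V → V} {s : V} {a L : ℕ}
    (hx : f^[L] (f^[a] s) = f^[a] s) (hneg : prefixWeight w f (f^[a] s) L < 0) :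
    stratEnergy w f s = ⊤ := by
  refine ENat.eq_top_iff_forall_ge.2 fun m => ?_
  set k : ℕ := m + (prefixWeight w f s a).toNat with hk
  refine le_trans ?_ (neg_prefixWeight_le_stratEnergy w f s (a + L * k))
  rw [prefixWeight_add, prefixWeight_mul_of_isPeriodicPt w hx]
  have h1 : (k : ℤ) * prefixWeight w f (f^[a] s) L ≤ (k : ℤ) * (-1) :=
    mul_le_mul_of_nonneg_left (by omega) (by positivity)
  have h2 : m ≤ (-(prefixWeight w f s a + k * prefixWeight w f (f^[a] s) L)).toNat := by
    omega
  exact_mod_cast h2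

theorem exists_short_prefixWeight_le {w : V → V → ℤ} {f : V → V} {s : V} {a L : ℕ}
    (hL : 0 < L) (hx : f^[L] (f^[a] s) = f^[a] s)
    (hnonneg : 0 ≤ prefixWeight w f (f^[a] s) L) (i : ℕ) :
    ∃ j ≤ a + L, prefixWeight w f s j ≤ prefixWeight w f s i := by
  induction i using Nat.strong_induction_on with
  | _ i ih =>
    by_cases hi : i ≤ a + L
    · exact ⟨i, hi, le_rfl⟩
    · obtain ⟨k, rfl⟩ : ∃ k, i = a + (L + k) := ⟨i - (a + L), by omega⟩
      obtain ⟨j, hj, hle⟩ := ih (a + k) (by omega)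
      refine ⟨j, hj, hle.trans ?_⟩
      rw [prefixWeight_add, prefixWeight_add, prefixWeight_add, hx]
      omega

theorem stratEnergy_le_roundW_add [Fintype V] (w : V → V → ℤ) {B : ℕ} (hB : 0 < B) (f : V → V) (s : V)
    (hpen : ∀ x : V, (∃ i : ℕ, f^[i] s = x) → ∀ L : ℕ, 0 < L → f^[L] x = x →
      (∀ k : ℕ, 0 < k → k < L → f^[k] x ≠ x) → cycleWeight w f x L < 0 →
      (cycleWeight w f x L : ℝ) / (L : ℝ) ≤ -(B : ℝ)) :
    stratEnergy w f s ≤ stratEnergy (roundW w (B : ℤ)) f s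
      + ((Fintype.card V * B : ℕ) : ℕ∞) := by
  have hB' : (0 : ℤ) < B := by exact_mod_cast hB
  obtain ⟨a, L, hL, haL, hx, hmin⟩ := exists_minimal_cycle f s
  by_cases hneg : prefixWeight w f (f^[a] s) L < 0
  · have h := hpen _ ⟨a, rfl⟩ L hL hx hmin hneg
    have hle : prefixWeight w f (f^[a] s) L ≤ -(B : ℤ) * L := by
      have h' := (div_le_iff₀ (by exact_mod_cast hL : (0 : ℝ) < L)).1 h
      exact_mod_cast h'
    have hlt := prefixWeight_roundW_lt w hB' f (f^[a] s) hL
    rw [stratEnergy_eq_top_of_neg_cycle (w := roundW w (B : ℤ)) hx (by linarith), top_add]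
    exact le_top
  · refine iSup_le fun i => ?_
    obtain ⟨j, hj, hle⟩ := exists_short_prefixWeight_le hL hx (not_lt.1 hneg) i
    refine le_trans ?_ (add_le_add_left (neg_prefixWeight_le_stratEnergy _ f s j) _)
    have h1 := prefixWeight_roundW_le w hB' f s j
    have h2 : (j : ℤ) * B ≤ ((Fintype.card V * B : ℕ) : ℤ) := by
      exact_mod_cast Nat.mul_le_mul_right B (hj.trans haL)
    have h3 : (-(prefixWeight w f s i)).toNat
        ≤ (-(prefixWeight (roundW w (B : ℤ)) f s j)).toNat + Fintype.card V * B := by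
      omega
    exact_mod_cast h3

end Play

end GameGraph

namespace GameGraph

variable {V : Type u} [Fintype V] [DecidableEq V]

theorem minEnergy_anti (G : GameGraph V) {w w' : V → V → ℤ} (h : ∀ a b, w a b ≤ w' a b)
    (s : V) : G.minEnergy w' s ≤ G.minEnergy w s :=
  iInf_mono fun _ => iSup_mono fun _ => stratEnergy_anti h _ s

/-- Let `c ≥ n` be an integer and `B = ⌊c/n⌋`.  For every node `v` with penalty at
least `B` we have
`e*_{G,w_B}(v) ≤ e*_{G,w}(v) ≤ e*_{G,w_B}(v) + nB ≤ e*_{G,w_B}(v) + c`,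
where `w_B(u,v) = ⌈w(u,v)/B⌉·B`. -/
theorem rounding_approximation (G : GameGraph V) (w : V → V → ℤ)
    (c : ℕ) (hc : Fintype.card V ≤ c)
    (B : ℕ) (hB : B = c / Fintype.card V)
    (v : V) (hpen : G.HasPenaltyAtLeast w v (B : ℝ)) :
    G.minEnergy (roundW w (B : ℤ)) v ≤ G.minEnergy w v ∧
    G.minEnergy w v ≤
      G.minEnergy (roundW w (B : ℤ)) v + ((Fintype.card V * B : ℕ) : ℕ∞) ∧
    G.minEnergy (roundW w (B : ℤ)) v + ((Fintype.card V * B : ℕ) : ℕ∞) ≤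
      G.minEnergy (roundW w (B : ℤ)) v + (c : ℕ∞) := by
  have hn : 0 < Fintype.card V := Fintype.card_pos_iff.2 ⟨v⟩
  have hBpos : 0 < B := hB ▸ Nat.div_pos hc hn
  refine ⟨G.minEnergy_anti (le_roundW w (by exact_mod_cast hBpos)) v, ?_, ?_⟩
  · obtain ⟨τ, hopt, hτ⟩ := hpen
    have hbound : ∀ σ : G.AliceStrategy, G.minEnergy w v ≤
        (⨆ τ : G.BobStrategy, stratEnergy (roundW w (B : ℤ)) (G.play σ τ) v)
          + ((Fintype.card V * B : ℕ) : ℕ∞) := fun σ =>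
      (hopt v σ).trans <| (stratEnergy_le_roundW_add w hBpos _ v (hτ σ)).trans <|
        add_le_add_left (le_iSup
          (fun τ : G.BobStrategy => stratEnergy (roundW w (B : ℤ)) (G.play σ τ) v) τ) _
    rw [← tsub_le_iff_right]
    exact le_iInf fun σ => tsub_le_iff_right.2 (hbound σ)
  · have h : Fintype.card V * B ≤ c := hB ▸ Nat.mul_div_le c _
    exact add_le_add_right (by exact_mod_cast h) _

end GameGraph
end

section
/- Let (G,w) be an energy game whose underlying game graph is ergodic, i.e., has no non-trivial ergodic partition. Then one player wins everywhere: either e*_{G,w}(v) < ∞ for every node v (Alice wins at every node), or e*_{G,w}(v) = ∞ for every node v (Bob wins at every node). -/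
/-!
Common definitions for energy games (Brim et al. style), following the paper's
definitions: a game graph is a finite directed graph in which every node has
out-degree at least one, together with a partition of the nodes into Alice's
nodes `VA` and Bob's nodes (the complement of `VA`).  Strategies are positional.
For a fixed pair of strategies the play from a node `s` is the orbit of the
induced successor function, and the minimal sufficient energy at `s` is the
least initial energy that keeps the running energy nonnegative forever, i.e.
`⨆ i, (-(weight of the length-i prefix))⁺ ∈ ℕ∞`; this coincides with
`∞` when the reachable cycle is negative and with `max (0, -min_P w(P))`
(minimum over simple paths `P` from `s`) otherwise.
-/

open scoped BigOperators

universe u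

namespace GameGraph

variable {V : Type u} [Fintype V] [DecidableEq V]

/-- An ergodic partition of a game graph: a partition `(SA, SB)` of the nodes such that
(1) every Alice node of `SA` has an edge staying in `SA`,
(2) no Bob node of `SA` has an edge into `SB`,
(3) every Bob node of `SB` has an edge staying in `SB`, and
(4) no Alice node of `SB` has an edge into `SA`. -/
def ErgodicPartition (G : GameGraph V) (SA SB : Finset V) : Prop :=
  SA ∪ SB = Finset.univ ∧ Disjoint SA SB ∧
  (∀ u ∈ SA, u ∈ G.VA → ∃ v ∈ SA, (u, v) ∈ G.E) ∧
  (∀ u ∈ SA, u ∉ G.VA → ∀ v ∈ SB, (u, v) ∉ G.E) ∧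
  (∀ u ∈ SB, u ∉ G.VA → ∃ v ∈ SB, (u, v) ∈ G.E) ∧
  (∀ u ∈ SB, u ∈ G.VA → ∀ v ∈ SA, (u, v) ∉ G.E)

theorem prefixWeight_succ {α : Type*} (w : α → α → ℤ) (f : α → α) (s : α) (i : ℕ) :
    prefixWeight w f s (i + 1) = w s (f s) + prefixWeight w f (f s) i := by
  simp only [prefixWeight, Finset.sum_range_succ' _ i, Function.iterate_succ_apply,
    Function.iterate_zero, id]
  ring

theorem stratEnergy_ne_top_iff {α : Type*} (w : α → α → ℤ) (f : α → α) (s : α) :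
    stratEnergy w f s ≠ ⊤ ↔ ∃ N : ℕ, ∀ i, -prefixWeight w f s i ≤ N := by
  constructor
  · intro h
    obtain ⟨N, hN⟩ := ENat.ne_top_iff_exists.mp h
    refine ⟨N, fun i => Int.toNat_le.mp ?_⟩
    have : ((-(prefixWeight w f s i)).toNat : ℕ∞) ≤ stratEnergy w f s :=
      le_iSup (fun i : ℕ => ((-(prefixWeight w f s i)).toNat : ℕ∞)) i
    rw [← hN] at this
    exact_mod_cast this
  · rintro ⟨N, hN⟩
    have : stratEnergy w f s ≤ (N : ℕ∞) :=
      iSup_le fun i => by exact_mod_cast Int.toNat_le.mpr (hN i)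
    exact ne_top_of_le_ne_top (ENat.natCast_ne_top N) this

theorem stratEnergy_apply_ne_top_iff {α : Type*} (w : α → α → ℤ) (f : α → α) (s : α) :
    stratEnergy w f (f s) ≠ ⊤ ↔ stratEnergy w f s ≠ ⊤ := by
  simp only [stratEnergy_ne_top_iff]
  constructor
  · rintro ⟨N, hN⟩
    refine ⟨N + (w s (f s)).natAbs, fun i => ?_⟩
    cases i with
    | zero => simp only [prefixWeight, Finset.range_zero, Finset.sum_empty]; omega
    | succ i =>
      have := hN i
      rw [prefixWeight_succ]
      omega
  · rintro ⟨N, hN⟩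
    refine ⟨N + (w s (f s)).natAbs, fun i => ?_⟩
    have := hN (i + 1)
    rw [prefixWeight_succ] at this
    omega

theorem stratEnergy_iterate_ne_top_iff {α : Type*} (w : α → α → ℤ) (f : α → α) (s : α) (n : ℕ) :
    stratEnergy w f (f^[n] s) ≠ ⊤ ↔ stratEnergy w f s ≠ ⊤ := by
  induction n with
  | zero => rfl
  | succ n ih => rw [Function.iterate_succ_apply', stratEnergy_apply_ne_top_iff, ih]

/-- The energy at `s` depends only on the successor function along the orbit of `s`. -/
theorem stratEnergy_congr {α : Type*} (w : α → α → ℤ) {f g : α → α} {s : α}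
    (h : ∀ n, g (f^[n] s) = f (f^[n] s)) : stratEnergy w g s = stratEnergy w f s := by
  have horbit : ∀ n, g^[n] s = f^[n] s := by
    intro n
    induction n with
    | zero => rfl
    | succ n ih => rw [Function.iterate_succ_apply', Function.iterate_succ_apply', ih, h]
  simp only [stratEnergy, prefixWeight, horbit]

/-- The strategy `σ` of Alice guarantees finite energy at `v` against every strategy of Bob. -/
def Wins (G : GameGraph V) (w : V → V → ℤ) (σ : G.AliceStrategy) (v : V) : Prop :=
  ∀ τ : G.BobStrategy, stratEnergy w (G.play σ τ) v ≠ ⊤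

instance (G : GameGraph V) : Finite G.BobStrategy :=
  inferInstanceAs (Finite {τ : V → V // ∀ u : V, u ∉ G.VA → (u, τ u) ∈ G.E})

instance (G : GameGraph V) : Nonempty G.AliceStrategy :=
  ⟨⟨fun v => (G.exists_succ v).choose, fun v _ => (G.exists_succ v).choose_spec⟩⟩

theorem minEnergy_ne_top_iff (G : GameGraph V) (w : V → V → ℤ) (v : V) :
    G.minEnergy w v ≠ ⊤ ↔ ∃ σ, G.Wins w σ v := by
  unfold minEnergy Wins
  rw [Ne, iInf_eq_top, not_forall]
  refine exists_congr fun σ => ⟨fun h τ => ?_, fun h => ?_⟩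
  · exact ne_top_of_le_ne_top h (le_iSup (fun τ => stratEnergy w (G.play σ τ) v) τ)
  · cases isEmpty_or_nonempty G.BobStrategy
    · simp
    · obtain ⟨τ, hτ⟩ := exists_eq_ciSup_of_finite (f := fun τ => stratEnergy w (G.play σ τ) v)
      rw [← hτ]
      exact h τ

theorem Wins.of_play {G : GameGraph V} {w : V → V → ℤ} {σ : G.AliceStrategy} {u : V}
    (h : ∀ τ, G.Wins w σ (G.play σ τ u)) : G.Wins w σ u := fun τ =>
  (stratEnergy_apply_ne_top_iff w _ u).mp (h τ τ)

theorem Wins.bob_edge {G : GameGraph V} {w : V → V → ℤ} {σ : G.AliceStrategy} {u v : V}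
    (h : G.Wins w σ u) (hu : u ∉ G.VA) (huv : (u, v) ∈ G.E) : G.Wins w σ v := by
  intro τ
  by_cases hreach : ∃ n, (G.play σ τ)^[n] v = u
  · obtain ⟨n, hn⟩ := hreach
    rw [← stratEnergy_iterate_ne_top_iff w _ v n, hn]
    exact h τ
  · push Not at hreach
    let τ' : G.BobStrategy := ⟨Function.update τ.1 u v, fun x hx => by
      by_cases hxu : x = u
      · subst hxu; simpa using huv
      · simpa [hxu] using τ.2 x hx⟩
    have hstep : G.play σ τ' u = v := by simp [play, hu, τ']
    rw [← stratEnergy_congr w (g := G.play σ τ') (f := G.play σ τ) fun n => by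
      simp [play, τ', hreach n]]
    have := (stratEnergy_apply_ne_top_iff w (G.play σ τ') u).mpr (h τ')
    rwa [hstep] at this

theorem Wins.play {G : GameGraph V} {w : V → V → ℤ} {σ : G.AliceStrategy} {u : V}
    (h : G.Wins w σ u) (τ : G.BobStrategy) : G.Wins w σ (G.play σ τ u) := by
  by_cases hu : u ∈ G.VA
  · intro τ'
    have := (stratEnergy_apply_ne_top_iff w (G.play σ τ') u).mpr (h τ')
    simpa [GameGraph.play, hu] using this
  · refine h.bob_edge hu ?_
    simpa [GameGraph.play, hu] using τ.2 u hu

theorem Wins.iterate {G : GameGraph V} {w : V → V → ℤ} {σ : G.AliceStrategy} {u : V}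
    (h : G.Wins w σ u) (τ : G.BobStrategy) (n : ℕ) : G.Wins w σ ((G.play σ τ)^[n] u) := by
  induction n with
  | zero => exact h
  | succ n ih => rw [Function.iterate_succ_apply']; exact ih.play τ

/-- Changing a strategy outside its winning region preserves its winning nodes. -/
theorem Wins.congr {G : GameGraph V} {w : V → V → ℤ} {σ σ' : G.AliceStrategy} {v : V}
    (h : G.Wins w σ v) (hσ : ∀ u, G.Wins w σ u → σ'.1 u = σ.1 u) : G.Wins w σ' v := by
  intro τ
  rw [stratEnergy_congr w (f := G.play σ τ) fun n => by
    simp only [GameGraph.play, hσ _ (h.iterate τ n)]]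
  exact h τ

theorem exists_wins_union (G : GameGraph V) (w : V → V → ℤ) (σ₁ σ₂ : G.AliceStrategy) :
    ∃ σ, ∀ v, G.Wins w σ₁ v ∨ G.Wins w σ₂ v → G.Wins w σ v := by
  classical
  let σ : G.AliceStrategy := ⟨fun x => if G.Wins w σ₁ x then σ₁.1 x else σ₂.1 x, fun x hx => by
    dsimp only
    split_ifs
    exacts [σ₁.2 x hx, σ₂.2 x hx]⟩
  have hσ₁ : ∀ v, G.Wins w σ₁ v → G.Wins w σ v := fun v hv =>
    hv.congr fun u hu => if_pos hu
  refine ⟨σ, fun v hv => hv.elim (hσ₁ v) fun hv τ => ?_⟩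
  by_cases hreach : ∃ n, G.Wins w σ₁ ((G.play σ τ)^[n] v)
  · obtain ⟨n, hn⟩ := hreach
    exact (stratEnergy_iterate_ne_top_iff w _ v n).mp (hσ₁ _ hn τ)
  · push Not at hreach
    rw [← stratEnergy_congr w (g := G.play σ₂ τ) fun n => by
      simp only [GameGraph.play, σ, if_neg (hreach n)]]
    exact hv τ

/-- Alice has one strategy that wins at every node at which she can win. -/
theorem exists_wins_of_exists_wins (G : GameGraph V) (w : V → V → ℤ) :
    ∃ σ, ∀ v, (∃ σ', G.Wins w σ' v) → G.Wins w σ v := by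
  suffices h : ∀ S : Finset V, ∃ σ, ∀ v ∈ S, (∃ σ', G.Wins w σ' v) → G.Wins w σ v by
    simpa using h Finset.univ
  intro S
  induction S using Finset.induction_on with
  | empty => exact ⟨Classical.arbitrary _, by simp⟩
  | insert a S _ ih =>
    obtain ⟨σ₁, h₁⟩ := ih
    by_cases ha : ∃ σ', G.Wins w σ' a
    · obtain ⟨σ₂, h₂⟩ := ha
      obtain ⟨σ, hσ⟩ := exists_wins_union G w σ₁ σ₂
      refine ⟨σ, fun v hv hex => hσ v ?_⟩
      rcases Finset.mem_insert.mp hv with rfl | hv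
      exacts [Or.inr h₂, Or.inl (h₁ v hv hex)]
    · refine ⟨σ₁, fun v hv hex => ?_⟩
      rcases Finset.mem_insert.mp hv with rfl | hv
      exacts [absurd hex ha, h₁ v hv hex]

/-- The winning regions of the two players form an ergodic partition. -/
theorem ergodicPartition_winningRegions (G : GameGraph V) (w : V → V → ℤ) {SA SB : Finset V}
    (hSA : ∀ v, v ∈ SA ↔ G.minEnergy w v ≠ ⊤) (hSB : ∀ v, v ∈ SB ↔ G.minEnergy w v = ⊤) :
    ErgodicPartition G SA SB := by
  obtain ⟨σ, hσ⟩ := exists_wins_of_exists_wins G w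
  have hA : ∀ v, v ∈ SA ↔ G.Wins w σ v := fun v => by
    rw [hSA, minEnergy_ne_top_iff]
    exact ⟨hσ v, fun h => ⟨σ, h⟩⟩
  have hB : ∀ v, v ∈ SB ↔ v ∉ SA := fun v => by rw [hSB, hSA, not_not]
  refine ⟨?_, ?_, ?_, ?_, ?_, ?_⟩
  · ext v
    simp [hB, em]
  · exact Finset.disjoint_left.mpr fun v hv hv' => (hB v).mp hv' hv
  · intro u hu huA
    refine ⟨σ.1 u, (hA _).mpr fun τ => ?_, σ.2 u huA⟩
    have := (stratEnergy_apply_ne_top_iff w (G.play σ τ) u).mpr ((hA u).mp hu τ)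
    simpa [play, huA] using this
  · intro u hu huA v hv huv
    exact (hB v).mp hv ((hA v).mpr (((hA u).mp hu).bob_edge huA huv))
  · intro u hu huA
    by_contra! hout
    refine (hB u).mp hu ((hA u).mpr (Wins.of_play fun τ => (hA _).mp ?_))
    by_contra hτ
    refine hout _ ((hB _).mpr hτ) ?_
    simpa [play, huA] using τ.2 u huA
  · intro u hu huA v hv huv
    have hu' := (hB u).mp hu
    let σ' : G.AliceStrategy := ⟨Function.update σ.1 u v, fun x hx => by
      by_cases hxu : x = u
      · subst hxu; simpa using huv
      · simpa [hxu] using σ.2 x hx⟩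
    have hv' : G.Wins w σ' v := ((hA v).mp hv).congr fun x hx => by
      have hxu : x ≠ u := fun h => hu' (h ▸ (hA x).mpr hx)
      simp [σ', hxu]
    exact hu' ((hA u).mpr (hσ u ⟨σ', Wins.of_play fun τ => by simpa [play, huA, σ'] using hv'⟩))

/-- In an energy game whose underlying game graph is ergodic (no non-trivial
ergodic partition), one player wins everywhere: either `e*_{G,w}(v) < ∞` for every
node `v` (Alice wins everywhere) or `e*_{G,w}(v) = ∞` for every node `v`
(Bob wins everywhere). -/
theorem ergodic_one_player_wins_everywhere (G : GameGraph V) (w : V → V → ℤ)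
    (herg : ¬ ∃ SA SB : Finset V,
        SA.Nonempty ∧ SB.Nonempty ∧ ErgodicPartition G SA SB) :
    (∀ v : V, G.minEnergy w v ≠ ⊤) ∨ (∀ v : V, G.minEnergy w v = ⊤) := by
  let SA : Finset V := {v | G.minEnergy w v ≠ ⊤}
  let SB : Finset V := {v | G.minEnergy w v = ⊤}
  by_contra! h
  obtain ⟨⟨a, ha⟩, b, hb⟩ := h
  exact herg ⟨SA, SB, ⟨b, by simpa [SA] using hb⟩, ⟨a, by simpa [SB] using ha⟩,
    ergodicPartition_winningRegions G w (by simp [SA]) (by simp [SB])⟩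

end GameGraph
end
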